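/- arXiv:1407.3784 — 5 statements merged into one kernel-verified Lean document; each statement's English description precedes it below -/
import Mathlib

section
/- Let k be a field of characteristic not 2, let K be a field extension of k, and let n ≥ 1. If A is an invertible 2n×2n matrix over K such that A commutes with (the image in K of) every matrix in Sp(2n,k), i.e. A·X = X·A for every X ∈ Sp(2n,k) viewed as a matrix over K, then A = p·I for some scalar p ∈ K. -/
open Matrix

/-- The standard symplectic form matrix `J = [[0, Iₙ], [-Iₙ, 0]]`. -/
def SpJ (n : ℕ) (R : Type*) [CommRing R] : Matrix (Fin n ⊕ Fin n) (Fin n ⊕ Fin n) R :=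
  Matrix.fromBlocks 0 1 (-1) 0

/-- `M` belongs to the symplectic group `Sp(2n,R)`, i.e. `Mᵀ J M = J`. -/
def IsSymp {n : ℕ} {R : Type*} [CommRing R]
    (M : Matrix (Fin n ⊕ Fin n) (Fin n ⊕ Fin n) R) : Prop :=
  Mᵀ * SpJ n R * M = SpJ n R

lemma isSymp_fromBlocks_one_symm_zero_one {n : ℕ} {R : Type*} [CommRing R]
    {B : Matrix (Fin n) (Fin n) R} (hB : B.IsSymm) : IsSymp (fromBlocks 1 B 0 1) := by
  simp [IsSymp, SpJ, fromBlocks_transpose, fromBlocks_multiply, hB.eq]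

lemma isSymp_fromBlocks_one_zero_one_one {n : ℕ} {R : Type*} [CommRing R] :
    IsSymp (fromBlocks 1 0 1 1 : Matrix (Fin n ⊕ Fin n) (Fin n ⊕ Fin n) R) := by
  simp [IsSymp, SpJ, fromBlocks_transpose, fromBlocks_multiply]

/-- A matrix over `K` commuting with every symmetric matrix over `k` is scalar. -/
lemma mem_range_scalar_of_commute_symm {k K ι : Type*} [Field k] [Field K] [Algebra k K]
    [Fintype ι] [DecidableEq ι] (P : Matrix ι ι K)
    (h : ∀ B : Matrix ι ι k, B.IsSymm → Commute (B.map (algebraMap k K)) P) :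
    P ∈ Set.range (scalar ι) := by
  refine mem_range_scalar_of_commute_single fun i j hij => ?_
  have h₁ := h (single i i 1) (by simp [Matrix.IsSymm])
  have h₂ := h (single i j 1 + single j i 1) (by simp [Matrix.IsSymm, add_comm])
  have h₃ : (single i j 1 : Matrix ι ι K) = (single i i 1 : Matrix ι ι k).map (algebraMap k K) *
      (single i j 1 + single j i 1 : Matrix ι ι k).map (algebraMap k K) := by
    rw [← Matrix.map_mul, mul_add, single_mul_single_same,
      single_mul_single_of_ne (h := hij)]
    simp
  simp only [h₃]
  exact h₁.mul_left h₂

/-- If an invertible matrix `A` over a field extension `K` of `k` commutes with (the image of)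
every matrix in `Sp(2n,k)`, then `A` is a scalar multiple of the identity. -/
theorem stmt0 {k K : Type*} [Field k] [Field K] [Algebra k K]
    (hchar : (2 : k) ≠ 0) {n : ℕ} (hn : 1 ≤ n)
    (A : Matrix (Fin n ⊕ Fin n) (Fin n ⊕ Fin n) K) (hA : IsUnit A)
    (hcomm : ∀ X : Matrix (Fin n ⊕ Fin n) (Fin n ⊕ Fin n) k, IsSymp X →
      A * X.map (algebraMap k K) = X.map (algebraMap k K) * A) :
    ∃ p : K, A = p • (1 : Matrix (Fin n ⊕ Fin n) (Fin n ⊕ Fin n) K) := by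
  obtain ⟨P, Q, R, S, rfl⟩ : ∃ P Q R S, A = fromBlocks P Q R S :=
    ⟨_, _, _, _, (fromBlocks_toBlocks A).symm⟩
  have upper : ∀ B : Matrix (Fin n) (Fin n) k, B.IsSymm →
      B.map (algebraMap k K) * R = 0 ∧
        P * B.map (algebraMap k K) + Q = Q + B.map (algebraMap k K) * S := fun B hB => by
    have h := hcomm _ (isSymp_fromBlocks_one_symm_zero_one hB)
    simp only [fromBlocks_map, fromBlocks_multiply, fromBlocks_inj] at h
    simpa using And.intro h.1 h.2.1
  have h_one := upper 1 (by simp [Matrix.IsSymm])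
  have hR : R = 0 := by simpa using h_one.1
  have hS : P = S := by simpa [add_comm Q] using h_one.2
  have hQ : Q = 0 := by
    have h := hcomm _ isSymp_fromBlocks_one_zero_one_one
    simp only [fromBlocks_map, fromBlocks_multiply, fromBlocks_inj] at h
    simpa using h.1
  obtain ⟨p, rfl⟩ := mem_range_scalar_of_commute_symm (k := k) P fun B hB => by
    have h := (upper B hB).2
    rw [hQ, add_zero, zero_add, ← hS] at h
    exact h.symm
  refine ⟨p, ?_⟩
  rw [← hS, hQ, hR, ← fromBlocks_one, fromBlocks_smul]
  simp [smul_one_eq_diagonal]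
end

section
/- Let k̄ be an algebraically closed field of characteristic not 2 and n ≥ 1. For an invertible 2n×2n matrix A over k̄, the inner automorphism Inn_A(X) = A⁻¹XA maps Sp(2n,k̄) into itself (i.e. A⁻¹XA ∈ Sp(2n,k̄) for all X ∈ Sp(2n,k̄)) if and only if there exist a nonzero scalar p ∈ k̄ and a matrix M ∈ Sp(2n,k̄) such that A = p·M. -/
open Matrix

section SpJ

variable {n : ℕ} {R : Type*} [CommRing R]

theorem SpJ_transpose : (SpJ n R)ᵀ = -SpJ n R := by
  simp [SpJ, fromBlocks_transpose, fromBlocks_neg]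

theorem SpJ_mul_self : SpJ n R * SpJ n R = -1 := by
  simp [SpJ, fromBlocks_multiply, ← fromBlocks_one, fromBlocks_neg]

theorem dotProduct_SpJ_mulVec_self (v : Fin n ⊕ Fin n → R) : v ⬝ᵥ (SpJ n R *ᵥ v) = 0 := by
  simp [SpJ, fromBlocks_mulVec, dotProduct, Fintype.sum_sum_type, mul_comm, neg_mulVec]

theorem vecMulVec_mul_SpJ_mul_vecMulVec (v : Fin n ⊕ Fin n → R) :
    vecMulVec v v * SpJ n R * vecMulVec v v = 0 := by
  rw [Matrix.mul_assoc, mul_vecMulVec, vecMulVec_mul_vecMulVec, dotProduct_SpJ_mulVec_self]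
  simp

/-- The transpose of the symplectic transvection `1 + v vᵀ J`. -/
theorem transpose_one_add_vecMulVec_mul_SpJ (v : Fin n ⊕ Fin n → R) :
    (1 + vecMulVec v v * SpJ n R)ᵀ = 1 - SpJ n R * vecMulVec v v := by
  simp [transpose_add, transpose_mul, transpose_vecMulVec, SpJ_transpose, sub_eq_add_neg]

theorem isSymp_one_add_vecMulVec_mul_SpJ (v : Fin n ⊕ Fin n → R) :
    IsSymp (1 + vecMulVec v v * SpJ n R) := by
  have h := vecMulVec_mul_SpJ_mul_vecMulVec v
  rw [IsSymp, transpose_one_add_vecMulVec_mul_SpJ]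
  calc _ = SpJ n R - SpJ n R * (vecMulVec v v * SpJ n R * vecMulVec v v) * SpJ n R := by
        noncomm_ring
    _ = SpJ n R := by rw [h, Matrix.mul_zero, Matrix.zero_mul, sub_zero]

/-- If a symplectic transvection preserves the bilinear form `K`, then `J K` and `K J` are
intertwined by `v vᵀ`. -/
theorem SpJ_mul_mul_vecMulVec_of_invariant {K : Matrix (Fin n ⊕ Fin n) (Fin n ⊕ Fin n) R}
    {v : Fin n ⊕ Fin n → R}
    (hK : (1 + vecMulVec v v * SpJ n R)ᵀ * K * (1 + vecMulVec v v * SpJ n R) = K) :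
    SpJ n R * K * vecMulVec v v = vecMulVec v v * (K * SpJ n R) := by
  rw [transpose_one_add_vecMulVec_mul_SpJ] at hK
  have h := vecMulVec_mul_SpJ_mul_vecMulVec v
  have hJ : SpJ n R * SpJ n R = -1 := SpJ_mul_self
  generalize vecMulVec v v = N at *
  generalize SpJ n R = J at *
  have hinv : (1 + J * N) * (1 - J * N) = 1 := by
    calc _ = 1 - J * (N * J * N) := by noncomm_ring
      _ = 1 := by rw [h, Matrix.mul_zero, sub_zero]
  have hcomm : K * N * J = J * N * K := by
    have := congrArg ((1 + J * N) * ·) hK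
    simp only [← Matrix.mul_assoc, hinv, Matrix.one_mul] at this
    rwa [Matrix.mul_add, Matrix.add_mul, Matrix.mul_one, Matrix.one_mul, add_right_inj,
      ← Matrix.mul_assoc] at this
  have hJl (X : Matrix (Fin n ⊕ Fin n) (Fin n ⊕ Fin n) R) : J * (J * X) = -X := by
    rw [← Matrix.mul_assoc, hJ, Matrix.neg_mul, Matrix.one_mul]
  have := congrArg (J * · * J) hcomm
  simpa only [Matrix.mul_assoc, hJl, hJ, Matrix.mul_neg, Matrix.mul_one, Matrix.neg_mul,
    neg_inj] using this

end SpJ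

/-- A matrix having every vector as an eigenvector, in the form of an identity of rank one
matrices, is scalar. -/
theorem exists_eq_smul_one_of_mul_vecMulVec {ι k : Type*} [Fintype ι] [DecidableEq ι] [Field k]
    {L L' : Matrix ι ι k} (h : ∀ v, L * vecMulVec v v = vecMulVec v v * L') :
    ∃ a : k, L = a • (1 : Matrix ι ι k) := by
  obtain ⟨a, ha⟩ := (toLin' L).exists_eq_smul_id_of_forall_notLinearIndependent fun v ↦ by
    by_cases hv : v = 0
    · simp [hv, linearIndependent_fin2]
    · obtain ⟨b, hb⟩ := Function.ne_iff.1 hv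
      rw [LinearIndependent.pair_iff' hv]
      push Not
      refine ⟨(v ᵥ* L') b / v b, funext fun i ↦ ?_⟩
      have hi := congrFun₂ (h v) i b
      rw [mul_vecMulVec, vecMulVec_mul, vecMulVec_apply, vecMulVec_apply] at hi
      rw [Pi.zero_apply] at hb
      rw [toLin'_apply, Pi.smul_apply, smul_eq_mul]
      field_simp
      linear_combination -hi
  refine ⟨a, toLin'.injective ?_⟩
  rw [ha, map_smul, toLin'_one]
  rfl

/-- A bilinear form invariant under the symplectic group is a multiple of the symplectic form. -/
theorem exists_eq_smul_SpJ_of_invariant {n : ℕ} {k : Type*} [Field k]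
    {K : Matrix (Fin n ⊕ Fin n) (Fin n ⊕ Fin n) k} (hK : ∀ X, IsSymp X → Xᵀ * K * X = K) :
    ∃ c : k, K = c • SpJ n k := by
  obtain ⟨a, ha⟩ := exists_eq_smul_one_of_mul_vecMulVec fun v ↦
    SpJ_mul_mul_vecMulVec_of_invariant (hK _ (isSymp_one_add_vecMulVec_mul_SpJ v))
  refine ⟨-a, ?_⟩
  have := congrArg (SpJ n k * ·) ha
  simp only [← Matrix.mul_assoc, SpJ_mul_self, Matrix.neg_mul, Matrix.one_mul, Matrix.mul_smul,
    Matrix.mul_one] at this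
  rw [neg_smul, ← this, neg_neg]

theorem SpJ_ne_zero {n : ℕ} (hn : 1 ≤ n) (R : Type*) [CommRing R] [Nontrivial R] :
    SpJ n R ≠ 0 := fun h ↦ by
  have := congrFun₂ h (Sum.inl ⟨0, hn⟩) (Sum.inr ⟨0, hn⟩)
  simp [SpJ] at this

/-- Over an algebraically closed field of characteristic not 2, the inner automorphism
`Inn_A` of an invertible matrix `A` maps `Sp(2n,k̄)` into itself iff `A` is a nonzero
scalar multiple of a symplectic matrix. -/
theorem stmt1 {k : Type*} [Field k] [IsAlgClosed k] (hchar : (2 : k) ≠ 0)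
    {n : ℕ} (hn : 1 ≤ n)
    (A : Matrix (Fin n ⊕ Fin n) (Fin n ⊕ Fin n) k) (hA : IsUnit A) :
    (∀ X : Matrix (Fin n ⊕ Fin n) (Fin n ⊕ Fin n) k, IsSymp X → IsSymp (A⁻¹ * X * A)) ↔
      ∃ p : k, p ≠ 0 ∧ ∃ M : Matrix (Fin n ⊕ Fin n) (Fin n ⊕ Fin n) k,
        IsSymp M ∧ A = p • M := by
  have hdet : IsUnit A.det := (isUnit_iff_isUnit_det A).1 hA
  have hBA : A⁻¹ * A = 1 := nonsing_inv_mul A hdet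
  have hAB : A * A⁻¹ = 1 := mul_nonsing_inv A hdet
  generalize A⁻¹ = B at *
  have hBAt : Aᵀ * Bᵀ = 1 := by rw [← transpose_mul, hBA, transpose_one]
  have hABt : Bᵀ * Aᵀ = 1 := by rw [← transpose_mul, hAB, transpose_one]
  constructor
  · intro h
    obtain ⟨c, hc⟩ : ∃ c : k, Bᵀ * SpJ n k * B = c • SpJ n k := by
      refine exists_eq_smul_SpJ_of_invariant fun X hX ↦ ?_
      have hX' := h X hX
      rw [IsSymp, transpose_mul, transpose_mul] at hX'
      calc Xᵀ * (Bᵀ * SpJ n k * B) * X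
          = (Bᵀ * Aᵀ) * (Xᵀ * (Bᵀ * SpJ n k * B) * X) * (A * B) := by simp [hABt, hAB]
        _ = Bᵀ * (Aᵀ * (Xᵀ * Bᵀ) * SpJ n k * (B * X * A)) * B := by
          simp only [Matrix.mul_assoc]
        _ = Bᵀ * SpJ n k * B := by rw [hX']
    have hJ : SpJ n k = c • (Aᵀ * SpJ n k * A) := by
      calc SpJ n k = (Aᵀ * Bᵀ) * SpJ n k * (B * A) := by simp [hBAt, hBA]
        _ = Aᵀ * (Bᵀ * SpJ n k * B) * A := by simp only [Matrix.mul_assoc]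
        _ = c • (Aᵀ * SpJ n k * A) := by rw [hc, Matrix.mul_smul, Matrix.smul_mul]
    have hc0 : c ≠ 0 := by
      rintro rfl
      exact SpJ_ne_zero hn k (by rw [hJ, zero_smul])
    obtain ⟨q, hq⟩ := IsAlgClosed.exists_pow_nat_eq c two_pos
    have hq0 : q ≠ 0 := by
      rintro rfl
      exact hc0 (by rw [← hq]; simp)
    refine ⟨q⁻¹, inv_ne_zero hq0, q • A, ?_, by rw [smul_smul, inv_mul_cancel₀ hq0, one_smul]⟩
    rw [IsSymp, transpose_smul, Matrix.smul_mul, Matrix.smul_mul, Matrix.mul_smul, smul_smul,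
      ← sq, hq, ← hJ]
  · rintro ⟨p, hp, M, hM, hAM⟩ X hX
    have hAJ : Aᵀ * SpJ n k * A = p ^ 2 • SpJ n k := by
      rw [hAM, transpose_smul, Matrix.smul_mul, Matrix.smul_mul, Matrix.mul_smul, smul_smul,
        ← sq, hM]
    have hBJ : p ^ 2 • (Bᵀ * SpJ n k * B) = SpJ n k := by
      rw [← Matrix.smul_mul, ← Matrix.mul_smul, ← hAJ]
      calc Bᵀ * (Aᵀ * SpJ n k * A) * B = (Bᵀ * Aᵀ) * SpJ n k * (A * B) := by
            simp only [Matrix.mul_assoc]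
        _ = SpJ n k := by simp [hABt, hAB]
    refine smul_right_injective _ (pow_ne_zero 2 hp) ?_
    change p ^ 2 • ((B * X * A)ᵀ * SpJ n k * (B * X * A)) = p ^ 2 • SpJ n k
    calc p ^ 2 • ((B * X * A)ᵀ * SpJ n k * (B * X * A))
        = Aᵀ * (Xᵀ * (p ^ 2 • (Bᵀ * SpJ n k * B)) * X) * A := by
          simp only [transpose_mul, Matrix.mul_assoc, Matrix.mul_smul, Matrix.smul_mul]
      _ = p ^ 2 • SpJ n k := by rw [hBJ, hX, hAJ]
end

section
/- Let k be a field of characteristic not 2 and n ≥ 1. If A ∈ Sp(2n,k) satisfies A² = I, then there exist a natural number m with m ≤ n and a matrix X ∈ Sp(2n,k) such that A = X·D·X⁻¹, where D is the 2n×2n block-diagonal matrix [[D₀, 0],[0, D₀]] and D₀ is the n×n diagonal matrix whose first m diagonal entries equal 1 and whose remaining n − m diagonal entries equal -1. -/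
open Matrix

/-- An isometric involution `T` of a nondegenerate alternating space admits hyperbolic systems of
eigenvectors of every admissible length `r`. -/
theorem exists_hyperbolic_eigenvectors {k V : Type*} [Field k] (hchar : (2 : k) ≠ 0)
    [AddCommGroup V] [Module k V] [FiniteDimensional k V]
    (B : LinearMap.BilinForm k V) (hB : B.IsAlt) (hnd : ∀ v, (∀ w, B v w = 0) → v = 0)
    (T : V →ₗ[k] V) (hT : ∀ v, T (T v) = v) (hBT : ∀ v w, B (T v) (T w) = B v w)
    (r : ℕ) (hr : 2 * r ≤ Module.finrank k V) :
    ∃ (p q : Fin r → V) (s : Fin r → k), (∀ i, s i = 1 ∨ s i = -1) ∧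
      (∀ i j, B (p i) (p j) = 0) ∧ (∀ i j, B (q i) (q j) = 0) ∧
      (∀ i j, B (p i) (q j) = if i = j then 1 else 0) ∧
      (∀ i, T (p i) = s i • p i) ∧ (∀ i, T (q i) = s i • q i) := by
  induction r with
  | zero => exact ⟨Fin.elim0, Fin.elim0, Fin.elim0, by simp⟩
  | succ r ih =>
    obtain ⟨p, q, s, hs, hpp, hqq, hpq, hTp, hTq⟩ := ih (by omega)
    have hneg : ∀ x y, B x y = -B y x := fun x y => (hB.neg_eq y x).symm
    have hBT' : ∀ x y, B x (T y) = B (T x) y := fun x y => by rw [← hBT x (T y), hBT, ← hBT, hT]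
    have hqp : ∀ i j, B (q i) (p j) = if i = j then -1 else 0 := fun i j => by
      rw [hneg, hpq, apply_ite Neg.neg, neg_zero]
      simp only [eq_comm]
    obtain ⟨v, hv0, hpv, hqv⟩ : ∃ v, v ≠ 0 ∧ (∀ i, B (p i) v = 0) ∧ (∀ i, B (q i) v = 0) := by
      let f : V →ₗ[k] (Fin r ⊕ Fin r → k) :=
        LinearMap.pi (Sum.elim (fun i => B (p i)) (fun i => B (q i)))
      have hf : LinearMap.ker f ≠ ⊥ := LinearMap.ker_ne_bot_of_finrank_lt (by simp; omega)
      obtain ⟨v, hv, hv0⟩ := Submodule.exists_mem_ne_zero_of_ne_bot hf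
      have hv' : ∀ i, f v i = 0 := congrFun (LinearMap.mem_ker.1 hv)
      exact ⟨v, hv0, fun i => hv' (Sum.inl i), fun i => hv' (Sum.inr i)⟩
    obtain ⟨t, u, ht, hu0, hTu, hpu, hqu⟩ : ∃ (t : k) (u : V), (t = 1 ∨ t = -1) ∧ u ≠ 0 ∧
        T u = t • u ∧ (∀ i, B (p i) u = 0) ∧ (∀ i, B (q i) u = 0) := by
      by_cases h : v + T v = 0
      · refine ⟨-1, v, Or.inr rfl, hv0, ?_, hpv, hqv⟩
        rw [neg_one_smul]
        exact (neg_eq_of_add_eq_zero_right h).symm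
      · exact ⟨1, v + T v, Or.inl rfl, h, by simp [hT, add_comm],
          fun i => by simp [hBT', hTp, hpv], fun i => by simp [hBT', hTq, hqv]⟩
    have htt : t * t = 1 := by rcases ht with rfl | rfl <;> simp
    obtain ⟨w, huw⟩ : ∃ w, B u w = 1 := by
      by_contra! h
      refine hu0 (hnd u fun w => by_contra fun hw => h ((B u w)⁻¹ • w) ?_)
      simp [hw]
    have hup : ∀ i, B u (p i) = 0 := fun i => by rw [hneg, hpu, neg_zero]
    have huq : ∀ i, B u (q i) = 0 := fun i => by rw [hneg, hqu, neg_zero]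
    obtain ⟨x, hux, hpx, hqx⟩ :
        ∃ x, B u x = 1 ∧ (∀ i, B (p i) x = 0) ∧ (∀ i, B (q i) x = 0) :=
      ⟨w - ∑ i, B (p i) w • q i + ∑ i, B (q i) w • p i, by simp [huw, hup, huq],
        by simp [hpp, hpq], by simp [hqq, hqp]⟩
    obtain ⟨y, huy, hTy, hpy, hqy⟩ : ∃ y, B u y = 1 ∧ T y = t • y ∧
        (∀ i, B (p i) y = 0) ∧ (∀ i, B (q i) y = 0) := by
      refine ⟨(2 : k)⁻¹ • (x + t • T x), ?_, ?_, fun i => by simp [hBT', hTp, hpx],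
        fun i => by simp [hBT', hTq, hqx]⟩
      · simp only [map_smul, map_add, hBT', hTu, LinearMap.smul_apply, hux, smul_eq_mul, mul_one,
          htt]
        field_simp
        norm_num
      · simp only [map_smul, map_add, hT]
        rw [smul_comm t, smul_add t, smul_smul t, htt, one_smul, add_comm]
    have hyq : ∀ i, B y (q i) = 0 := fun i => by rw [hneg, hqy, neg_zero]
    refine ⟨Fin.cons u p, Fin.cons y q, Fin.cons t s, ?_, ?_, ?_, ?_, ?_, ?_⟩ <;>
      simp [Fin.forall_fin_succ, hs, hpp, hqq, hpq, hTp, hTq, ht, hTu, hpu, hup, huq, huy, hTy, hpy,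
        hqy, hyq, hB.self_eq_zero, (Fin.succ_ne_zero _).symm]

/-- The indices satisfying a predicate on `Fin n` can be moved to the front by a permutation. -/
theorem exists_perm_lt_iff {n : ℕ} (P : Fin n → Prop) :
    ∃ m ≤ n, ∃ e : Equiv.Perm (Fin n), ∀ i : Fin n, P (e i) ↔ (i : ℕ) < m := by
  classical
  have hm : Fintype.card {i // P i} ≤ n := by simpa using Fintype.card_subtype_le P
  refine ⟨_, hm, ?_⟩
  have hcard : Fintype.card {i : Fin n // (i : ℕ) < Fintype.card {i // P i}} =
      Fintype.card {i // P i} := by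
    rw [Fintype.card_subtype (fun i : Fin n => (i : ℕ) < _), Fin.card_filter_val_lt, min_eq_right hm]
  let e := Fintype.equivOfCardEq hcard
  refine ⟨e.extendSubtype, fun i => ⟨fun h => ?_, fun h => e.extendSubtype_mem i h⟩⟩
  by_contra hi
  exact e.extendSubtype_not_mem i hi h

/-- Any `A ∈ Sp(2n,k)` with `A² = I` is conjugate by a symplectic matrix `X ∈ Sp(2n,k)` to
the block diagonal matrix `[[D₀,0],[0,D₀]]` where `D₀` is diagonal with `m` ones followed
by `n - m` minus-ones. -/
theorem stmt5 {k : Type*} [Field k] (hchar : (2 : k) ≠ 0) {n : ℕ} (hn : 1 ≤ n)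
    (A : Matrix (Fin n ⊕ Fin n) (Fin n ⊕ Fin n) k) (hA : IsSymp A)
    (h2 : A * A = 1) :
    ∃ m ≤ n, ∃ X : Matrix (Fin n ⊕ Fin n) (Fin n ⊕ Fin n) k, IsSymp X ∧
      A = X * Matrix.fromBlocks
            (Matrix.diagonal (fun i : Fin n => if (i : ℕ) < m then (1 : k) else -1)) 0 0
            (Matrix.diagonal (fun i : Fin n => if (i : ℕ) < m then (1 : k) else -1))
          * X⁻¹ := by
  have hJJ : SpJ n k * SpJ n k = -1 := by
    simp [SpJ, fromBlocks_multiply, ← fromBlocks_one, fromBlocks_neg]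
  let B : LinearMap.BilinForm k (Fin n ⊕ Fin n → k) := Matrix.toBilin' (SpJ n k)
  have hBdef : ∀ v w, B v w = v ⬝ᵥ SpJ n k *ᵥ w := Matrix.toBilin'_apply' _
  have hB : B.IsAlt := fun v => by
    rw [hBdef]
    simp [SpJ, fromBlocks_mulVec, dotProduct, neg_mulVec, mul_comm]
  have hnd : ∀ v, (∀ w, B v w = 0) → v = 0 := fun v hv => by
    refine dotProduct_eq_zero v fun w => ?_
    have := hv (-(SpJ n k *ᵥ w))
    rwa [hBdef, mulVec_neg, mulVec_mulVec, hJJ, neg_mulVec, neg_neg, one_mulVec] at this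
  obtain ⟨p, q, s, hs, hpp, hqq, hpq, hTp, hTq⟩ :=
    exists_hyperbolic_eigenvectors hchar B hB hnd (Matrix.toLin' A)
      (fun v => by simp [h2])
      (fun v w => by
        simp only [hBdef, toLin'_apply]
        rw [← vecMul_transpose, ← dotProduct_mulVec, mulVec_mulVec, mulVec_mulVec,
          show Aᵀ * SpJ n k * A = SpJ n k from hA])
      n (by simp; omega)
  have hqp : ∀ i j, B (q i) (p j) = if i = j then -1 else 0 := fun i j => by
    rw [← hB.neg_eq, hpq, apply_ite Neg.neg, neg_zero]
    simp only [eq_comm]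
  obtain ⟨m, hm, e, he⟩ := exists_perm_lt_iff fun i => s i = 1
  have hse : ∀ i, s (e i) = if (i : ℕ) < m then (1 : k) else -1 := fun i => by
    split_ifs with h
    · exact (he i).2 h
    · exact (hs (e i)).resolve_left fun h' => h ((he i).1 h')
  let b : Fin n ⊕ Fin n → Fin n ⊕ Fin n → k := Sum.elim (p ∘ e) (q ∘ e)
  let X : Matrix (Fin n ⊕ Fin n) (Fin n ⊕ Fin n) k := (of b)ᵀ
  have hX : IsSymp X := by
    ext i j
    have : (Xᵀ * SpJ n k * X) i j = B (b i) (b j) := by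
      rw [hBdef, mul_assoc]
      rfl
    rw [this]
    rcases i with i | i <;> rcases j with j | j <;>
      simp [b, SpJ, hpp, hqq, hpq, hqp, one_apply, neg_ite]
  have hXu : IsUnit X.det := by
    have h1 : (-SpJ n k * Xᵀ * SpJ n k) * X = 1 := by
      rw [mul_assoc, mul_assoc, ← mul_assoc Xᵀ, show Xᵀ * SpJ n k * X = SpJ n k from hX,
        neg_mul, hJJ, neg_neg]
    exact isUnit_det_of_left_inverse h1
  refine ⟨m, hm, X, hX, ?_⟩
  have hAX : A * X = X * fromBlocks
      (diagonal (fun i : Fin n => if (i : ℕ) < m then (1 : k) else -1)) 0 0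
      (diagonal (fun i : Fin n => if (i : ℕ) < m then (1 : k) else -1)) := by
    rw [fromBlocks_diagonal]
    ext i j
    rw [mul_diagonal]
    change (A *ᵥ b j) i = b j i * _
    rcases j with j | j
    · simpa [b, hse, mul_comm] using congrFun (hTp (e j)) i
    · simpa [b, hse, mul_comm] using congrFun (hTq (e j)) i
  rw [← hAX, mul_nonsing_inv_cancel_right _ _ hXu]
end

section
/- Let k be a field of characteristic not 2, K a field extension of k, and s ∈ K an element with s² = α for some α ∈ k but with s not in the image of k in K. Let n ≥ 1 and suppose A ∈ Sp(2n,K) satisfies A² = I and every entry of A is a k-multiple of s (i.e. A_{i,j} = c_{i,j}·s with c_{i,j} in the image of k). Then: (1) for all vectors x, y ∈ k^{2n} (viewed in K^{2n}), if x + s·y lies in the eigenspace E(A,-1) then x - s·y lies in E(A,1), and if x + s·y lies in E(A,1) then x - s·y lies in E(A,-1); (2) the dimensions over K of E(A,1) and E(A,-1) are equal (hence each equals n). -/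
open Matrix

/-- The rank of a square matrix is invariant under field extension. -/
theorem Matrix.rank_map_ringHom {m F K : Type*} [Fintype m] [DecidableEq m] [Field F] [Field K]
    (f : F →+* K) (M : Matrix m m F) : (M.map f).rank = M.rank := by
  classical
  obtain ⟨V, U, e, hV, hU, h⟩ := M.exists_rank_normal_form
  have hV' : IsUnit (V.map f).det := (isUnit_iff_isUnit_det _).1 (hV.map f.mapMatrix)
  have hU' : IsUnit (U.map f).det := (isUnit_iff_isUnit_det _).1 (hU.map f.mapMatrix)
  have hmap : V.map f * M.map f * U.map f =
      (diagonal (Sum.elim (fun _ ↦ 1) fun _ ↦ 0)).submatrix e e := by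
    rw [← Matrix.map_mul, ← Matrix.map_mul, h]
    ext i j
    rcases hi : e i with a | a <;> rcases hj : e j with b | b <;>
      simp [hi, hj, diagonal_apply, one_apply, apply_ite f]
  rw [← rank_mul_eq_right_of_isUnit_det _ (M.map f) hV', ← rank_mul_eq_left_of_isUnit_det _ _ hU',
    hmap, rank_submatrix, rank_diagonal, Fintype.card_subtype, Finset.card_filter, Fintype.sum_sum_type]
  simp

open Polynomial in
/-- Conjugating `√α ↦ -√α` does not change the rank of `√α C - 1`. -/
theorem rank_smul_map_sub_one_eq {m k K : Type*} [Fintype m] [DecidableEq m] [Field k] [Field K]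
    [Algebra k K] {s : K} {α : k} (hs : s ^ 2 = algebraMap k K α)
    (hsk : s ∉ Set.range (algebraMap k K)) (C : Matrix m m k) :
    (s • C.map (algebraMap k K) - 1).rank = (s • C.map (algebraMap k K) + 1).rank := by
  have hα (b : k) : b ^ 2 ≠ α := by
    rintro rfl
    rw [map_pow, sq_eq_sq_iff_eq_or_eq_neg] at hs
    obtain rfl | rfl := hs
    · exact hsk ⟨b, rfl⟩
    · exact hsk ⟨-b, map_neg _ b⟩
  have : Fact (Irreducible (X ^ 2 - Polynomial.C α)) :=
    ⟨X_pow_sub_C_irreducible_of_prime Nat.prime_two hα⟩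
  let B := AdjoinRoot.root (X ^ 2 - Polynomial.C α) •
    C.map (AdjoinRoot.of (X ^ 2 - Polynomial.C α)) - 1
  have key (t : K) (ht : t ^ 2 = algebraMap k K α) :
      (t • C.map (algebraMap k K) - 1).rank = B.rank := by
    rw [← B.rank_map_ringHom (AdjoinRoot.lift (algebraMap k K) t (by simp [ht]))]
    congr 1
    ext i j
    by_cases hij : i = j <;> simp [B, one_apply, hij]
  rw [key s hs, ← key (-s) (by rw [neg_sq, hs]), neg_smul, ← neg_add', ← neg_one_smul K,
    rank_smul_of_mem_nonZeroDivisors _ (by simp)]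

/-- The fixed space of a matrix involution `A` is the range of `A + 1`. -/
theorem ker_sub_one_eq_range_add_one {m K : Type*} [Fintype m] [DecidableEq m] [Field K]
    (h2K : (2 : K) ≠ 0) {A : Matrix m m K} (h : A * A = 1) :
    LinearMap.ker (A - 1).mulVecLin = LinearMap.range (A + 1).mulVecLin := by
  ext v
  simp only [LinearMap.mem_ker, LinearMap.mem_range, mulVecLin_apply]
  constructor
  · intro hv
    rw [sub_mulVec, one_mulVec, sub_eq_zero] at hv
    refine ⟨(2 : K)⁻¹ • v, ?_⟩
    rw [mulVec_smul, add_mulVec, one_mulVec, hv, ← two_smul K v, smul_smul,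
      inv_mul_cancel₀ h2K, one_smul]
  · rintro ⟨w, rfl⟩
    rw [mulVec_mulVec, show (A - 1) * (A + 1) = 0 by noncomm_ring; simp [h], zero_mulVec]

/-- Eigenvector conjugation and equality of eigenspace dimensions for a Type 2 involution:
`A ∈ Sp(2n,K)` with `A² = I` whose entries are `k`-multiples of `s = √α ∉ k`. -/
theorem stmt7 {k K : Type*} [Field k] [Field K] [Algebra k K]
    (hchar : (2 : k) ≠ 0) (s : K) (α : k) (hs : s ^ 2 = algebraMap k K α)
    (hsk : s ∉ Set.range (algebraMap k K)) {n : ℕ} (hn : 1 ≤ n)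
    (A : Matrix (Fin n ⊕ Fin n) (Fin n ⊕ Fin n) K) (hA : IsSymp A)
    (h2 : A * A = 1)
    (hent : ∀ i j, ∃ c : k, A i j = algebraMap k K c * s) :
    (∀ x y : (Fin n ⊕ Fin n) → k,
      (A.mulVec ((fun i => algebraMap k K (x i)) + s • (fun i => algebraMap k K (y i)))
          = -((fun i => algebraMap k K (x i)) + s • (fun i => algebraMap k K (y i))) →
        A.mulVec ((fun i => algebraMap k K (x i)) - s • (fun i => algebraMap k K (y i)))
          = (fun i => algebraMap k K (x i)) - s • (fun i => algebraMap k K (y i))) ∧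
      (A.mulVec ((fun i => algebraMap k K (x i)) + s • (fun i => algebraMap k K (y i)))
          = (fun i => algebraMap k K (x i)) + s • (fun i => algebraMap k K (y i)) →
        A.mulVec ((fun i => algebraMap k K (x i)) - s • (fun i => algebraMap k K (y i)))
          = -((fun i => algebraMap k K (x i)) - s • (fun i => algebraMap k K (y i))))) ∧
    Module.finrank K (LinearMap.ker (A - 1).mulVecLin)
      = Module.finrank K (LinearMap.ker (A + 1).mulVecLin) ∧
    Module.finrank K (LinearMap.ker (A - 1).mulVecLin) = n ∧
    Module.finrank K (LinearMap.ker (A + 1).mulVecLin) = n := by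
  have h2K : (2 : K) ≠ 0 := by
    rw [← map_ofNat (algebraMap k K) 2]
    exact (map_ne_zero _).2 hchar
  choose C hC using hent
  have hAC : A = s • (Matrix.of C).map (algebraMap k K) := by
    ext i j
    simp [hC, mul_comm]
  have indep (a b : k) (h : algebraMap k K a + s * algebraMap k K b = 0) : a = 0 ∧ b = 0 := by
    have hb : b = 0 := by
      by_contra hb
      refine hsk ⟨-a / b, ?_⟩
      have : algebraMap k K b ≠ 0 := (map_ne_zero _).2 hb
      rw [map_div₀, map_neg]
      field_simp
      linear_combination -h
    subst hb
    exact ⟨by simpa using h, rfl⟩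
  have hmul (x y : Fin n ⊕ Fin n → k) (t : K) (i : Fin n ⊕ Fin n) :
      A.mulVec ((fun i => algebraMap k K (x i)) + t • (fun i => algebraMap k K (y i))) i =
        s * algebraMap k K ((Matrix.of C).mulVec x i) +
          s * t * algebraMap k K ((Matrix.of C).mulVec y i) := by
    simp only [hAC, mulVec, dotProduct, map_sum, map_mul, Finset.mul_sum,
      ← Finset.sum_add_distrib, Pi.add_apply, Pi.smul_apply, Matrix.smul_apply, map_apply, smul_eq_mul]
    exact Finset.sum_congr rfl fun _ _ ↦ by ring
  -- The eigenvalue is `algebraMap k K ε`, so that both signs are treated at once.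
  have conj (ε : k) (x y : Fin n ⊕ Fin n → k)
      (h : A.mulVec ((fun i => algebraMap k K (x i)) + s • (fun i => algebraMap k K (y i))) =
        algebraMap k K ε •
          ((fun i => algebraMap k K (x i)) + s • (fun i => algebraMap k K (y i)))) :
      A.mulVec ((fun i => algebraMap k K (x i)) - s • (fun i => algebraMap k K (y i))) =
        -algebraMap k K ε •
          ((fun i => algebraMap k K (x i)) - s • (fun i => algebraMap k K (y i))) := by
    ext i
    have hi := congrFun h i
    rw [hmul] at hi
    simp only [Pi.smul_apply, Pi.add_apply, smul_eq_mul] at hi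
    obtain ⟨h₀, h₁⟩ := indep (α * (Matrix.of C).mulVec y i - ε * x i)
      ((Matrix.of C).mulVec x i - ε * y i) (by
        simp only [map_sub, map_mul]
        linear_combination hi - algebraMap k K ((Matrix.of C).mulVec y i) * hs)
    replace h₀ := congrArg (algebraMap k K) h₀
    replace h₁ := congrArg (algebraMap k K) h₁
    simp only [map_sub, map_mul, map_zero] at h₀ h₁
    rw [sub_eq_add_neg, ← neg_smul, hmul]
    simp only [Pi.smul_apply, Pi.add_apply, smul_eq_mul]
    linear_combination s * h₁ - h₀ - algebraMap k K ((Matrix.of C).mulVec y i) * hs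
  have hrank : (A - 1).rank = (A + 1).rank := hAC ▸ rank_smul_map_sub_one_eq hs hsk (Matrix.of C)
  have hsub : Module.finrank K (LinearMap.ker (A - 1).mulVecLin) = (A + 1).rank := by
    rw [ker_sub_one_eq_range_add_one h2K h2, rank]
  have hdim₁ := LinearMap.finrank_range_add_finrank_ker (A - 1).mulVecLin
  have hdim₂ := LinearMap.finrank_range_add_finrank_ker (A + 1).mulVecLin
  rw [← rank] at hdim₁ hdim₂
  simp only [Module.finrank_fintype_fun_eq_card, Fintype.card_sum, Fintype.card_fin] at hdim₁ hdim₂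
  refine ⟨fun x y ↦ ⟨fun h ↦ ?_, fun h ↦ ?_⟩, by omega, by omega, by omega⟩
  · simpa using conj (-1) x y (by rw [h, map_neg, map_one, neg_one_smul])
  · simpa using conj 1 x y (by rw [h, map_one, one_smul])
end

section
/- Let k be a field of characteristic not 2, K a field extension of k containing an element i with i² = -1, and n ≥ 1. If A ∈ Sp(2n,k) satisfies A² = -I, then, viewing A as a matrix over K, the eigenspaces E(A,i) and E(A,-i) have equal dimension over K; consequently each has dimension n. -/
open Matrix

theorem SpJ_mul_SpJ (n : ℕ) (R : Type*) [CommRing R] : SpJ n R * SpJ n R = -1 := by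
  rw [SpJ, Matrix.fromBlocks_multiply, ← Matrix.fromBlocks_one, Matrix.fromBlocks_neg]
  simp

theorem isUnit_det_SpJ (n : ℕ) (R : Type*) [CommRing R] : IsUnit (SpJ n R).det :=
  Matrix.isUnit_det_of_left_inverse (B := -SpJ n R) (by rw [neg_mul, SpJ_mul_SpJ, neg_neg])

theorem IsSymp.map {n : ℕ} {R S : Type*} [CommRing R] [CommRing S] (f : R →+* S)
    {A : Matrix (Fin n ⊕ Fin n) (Fin n ⊕ Fin n) R} (hA : IsSymp A) : IsSymp (A.map f) := by
  have hJ : (SpJ n R).map f = SpJ n S := by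
    simp [SpJ, Matrix.fromBlocks_map, Matrix.map_neg]
  have h := congrArg (fun M => M.map f) hA
  simpa only [IsSymp, Matrix.map_mul, hJ, Matrix.transpose_map] using h

theorem IsSymp.transpose_mul_SpJ {n : ℕ} {R : Type*} [CommRing R]
    {A : Matrix (Fin n ⊕ Fin n) (Fin n ⊕ Fin n) R} (hA : IsSymp A) (h2 : A * A = -1) :
    Aᵀ * SpJ n R = -(SpJ n R * A) := by
  have h : Aᵀ * SpJ n R * (A * A) = SpJ n R * A := by
    rw [← mul_assoc, show Aᵀ * SpJ n R * A = SpJ n R from hA]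
  rw [← h, h2, mul_neg, mul_one, neg_neg]

theorem IsSymp.rank_sub_smul_one {n : ℕ} {K : Type*} [Field K]
    {A : Matrix (Fin n ⊕ Fin n) (Fin n ⊕ Fin n) K} (hA : IsSymp A) (h2 : A * A = -1) (c : K) :
    (A - c • 1).rank = (A + c • 1).rank := by
  have h : (A - c • 1)ᵀ * SpJ n K = (-SpJ n K) * (A + c • 1) := by
    rw [Matrix.transpose_sub, Matrix.transpose_smul, Matrix.transpose_one, sub_mul,
      hA.transpose_mul_SpJ h2, mul_add, smul_mul_assoc, one_mul, mul_smul_comm, mul_one,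
      neg_mul, smul_neg, sub_eq_add_neg]
  have hneg : IsUnit (-SpJ n K).det := by
    rw [← Matrix.isUnit_iff_isUnit_det]
    exact ((Matrix.isUnit_iff_isUnit_det _).2 (isUnit_det_SpJ n K)).neg
  rw [← Matrix.rank_transpose (A - c • 1),
    ← Matrix.rank_mul_eq_left_of_isUnit_det (SpJ n K) _ (isUnit_det_SpJ n K), h,
    Matrix.rank_mul_eq_right_of_isUnit_det _ _ hneg]

theorem isCompl_ker_sub_smul_one_ker_add_smul_one {m K : Type*} [Fintype m] [DecidableEq m]
    [Field K] (h2 : (2 : K) ≠ 0) {c : K} (hc : c ^ 2 = -1) {B : Matrix m m K}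
    (hB : B * B = -1) :
    IsCompl (LinearMap.ker (B - c • 1).mulVecLin) (LinearMap.ker (B + c • 1).mulVecLin) := by
  have hc0 : c ≠ 0 := by rintro rfl; simp at hc
  have hd : 2 * c ≠ 0 := mul_ne_zero h2 hc0
  have hcc : (c • (1 : Matrix m m K)) * (c • 1) = -1 := by
    rw [smul_mul_smul_comm, one_mul, ← sq, hc, neg_one_smul]
  have hcomm : B * (c • 1) = (c • 1) * B := by simp
  have hPQ : (B - c • 1) * (B + c • 1) = 0 := by
    rw [sub_mul, mul_add, mul_add, hB, hcc, hcomm]; abel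
  have hQP : (B + c • 1) * (B - c • 1) = 0 := by
    rw [add_mul, mul_sub, mul_sub, hB, hcc, hcomm]; abel
  have hsum (v : m → K) : (B + c • 1) *ᵥ v - (B - c • 1) *ᵥ v = (2 * c) • v := by
    rw [← Matrix.sub_mulVec, add_sub_sub_cancel, ← add_smul, ← two_mul, Matrix.smul_mulVec,
      Matrix.one_mulVec]
  constructor
  · rw [Submodule.disjoint_def]
    intro v hv hw
    rw [LinearMap.mem_ker, Matrix.mulVecLin_apply] at hv hw
    have h := hsum v
    rw [hv, hw, sub_zero] at h
    exact (smul_eq_zero.1 h.symm).resolve_left hd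
  · rw [codisjoint_iff, eq_top_iff]
    intro v _
    refine (Submodule.smul_mem_iff _ hd).1 ?_
    rw [← hsum]
    refine Submodule.sub_mem _ (Submodule.mem_sup_left ?_) (Submodule.mem_sup_right ?_)
    · rw [LinearMap.mem_ker, Matrix.mulVecLin_apply, Matrix.mulVec_mulVec, hPQ, Matrix.zero_mulVec]
    · rw [LinearMap.mem_ker, Matrix.mulVecLin_apply, Matrix.mulVec_mulVec, hQP, Matrix.zero_mulVec]

/-- If `A ∈ Sp(2n,k)` satisfies `A² = -I`, then over an extension `K` containing `i` with
`i² = -1`, the eigenspaces `E(A,i)` and `E(A,-i)` have the same dimension, namely `n`. -/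
theorem stmt11 {k K : Type*} [Field k] [Field K] [Algebra k K]
    (hchar : (2 : k) ≠ 0) (i : K) (hi : i ^ 2 = -1) {n : ℕ} (hn : 1 ≤ n)
    (A : Matrix (Fin n ⊕ Fin n) (Fin n ⊕ Fin n) k) (hA : IsSymp A)
    (h2 : A * A = -1) :
    Module.finrank K (LinearMap.ker (A.map (algebraMap k K) - i • 1).mulVecLin)
      = Module.finrank K (LinearMap.ker (A.map (algebraMap k K) + i • 1).mulVecLin) ∧
    Module.finrank K (LinearMap.ker (A.map (algebraMap k K) - i • 1).mulVecLin) = n ∧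
    Module.finrank K (LinearMap.ker (A.map (algebraMap k K) + i • 1).mulVecLin) = n := by
  have h2K : (2 : K) ≠ 0 := by
    rw [← map_ofNat (algebraMap k K) 2]
    exact (map_ne_zero (algebraMap k K)).2 hchar
  have hB : A.map (algebraMap k K) * A.map (algebraMap k K) = -1 := by
    rw [← Matrix.map_mul, h2]
    simp [Matrix.map_neg]
  have hcompl := Submodule.finrank_add_eq_of_isCompl
    (isCompl_ker_sub_smul_one_ker_add_smul_one h2K hi hB)
  have hrank := (hA.map (algebraMap k K)).rank_sub_smul_one hB i
  have hP := (A.map (algebraMap k K) - i • 1).mulVecLin.finrank_range_add_finrank_ker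
  have hQ := (A.map (algebraMap k K) + i • 1).mulVecLin.finrank_range_add_finrank_ker
  rw [Matrix.rank, Matrix.rank] at hrank
  simp only [Module.finrank_fintype_fun_eq_card, Fintype.card_sum, Fintype.card_fin] at hcompl hP hQ
  omega
end
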